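/- For r = 7: any two distinct (−1)-classes E, E' in ℤ^8 satisfy (E,E') ∈ {0, 1, 2}; in particular the only (−1)-class intersecting E negatively is E itself. Moreover, for each fixed (−1)-class E, there are exactly 27 (−1)-classes E' with (E,E') = 0, exactly 28 with (E,E') > 0, and exactly one with (E,E') = 2, namely E' = −K_7 − E. -/

import Mathlib

/-- The intersection form on `Pic = ℤ^8` with basis `H = e₀`, `E_1,…,E_7`:
`(H,H) = 1`, `(E_i,E_i) = −1`, all other products of distinct basis vectors `0`. -/
def ip (v w : Fin 8 → ℤ) : ℤ := v 0 * w 0 - ∑ i ∈ Finset.univ.erase 0, v i * w i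

/-- The canonical class `K_7 = −3H + E_1 + ⋯ + E_7`. -/
def K7 : Fin 8 → ℤ := fun i => if i = 0 then -3 else 1

/-- A `(−1)`-class: `(E,E) = −1` and `(E,K_7) = −1`. -/
def isClass (E : Fin 8 → ℤ) : Prop := ip E E = -1 ∧ ip E K7 = -1

theorem ip_eq_sub_sum_succ (v w : Fin 8 → ℤ) :
    ip v w = v 0 * w 0 - ∑ i : Fin 7, v i.succ * w i.succ := by
  rw [ip, Finset.sum_erase_eq_sub (Finset.mem_univ _), Fin.sum_univ_succ]
  ring

theorem ip_comm (v w : Fin 8 → ℤ) : ip v w = ip w v := by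
  simp only [ip, mul_comm]

theorem ip_add_left (u v w : Fin 8 → ℤ) : ip (u + v) w = ip u w + ip v w := by
  simp only [ip, Pi.add_apply, add_mul, Finset.sum_add_distrib]
  ring

theorem ip_neg_left (v w : Fin 8 → ℤ) : ip (-v) w = -ip v w := by
  simp only [ip, Pi.neg_apply, neg_mul, Finset.sum_neg_distrib]
  ring

theorem ip_sub_left (u v w : Fin 8 → ℤ) : ip (u - v) w = ip u w - ip v w := by
  rw [sub_eq_add_neg, ip_add_left, ip_neg_left, sub_eq_add_neg]

theorem ip_add_right (u v w : Fin 8 → ℤ) : ip w (u + v) = ip w u + ip w v := by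
  simp only [ip_comm w, ip_add_left]

theorem ip_neg_right (v w : Fin 8 → ℤ) : ip w (-v) = -ip w v := by
  simp only [ip_comm w, ip_neg_left]

theorem ip_sub_right (u v w : Fin 8 → ℤ) : ip w (u - v) = ip w u - ip w v := by
  simp only [ip_comm w, ip_sub_left]

theorem ip_K7_right (v : Fin 8 → ℤ) : ip v K7 = -3 * v 0 - ∑ i : Fin 7, v i.succ := by
  simp [ip_eq_sub_sum_succ, K7, Fin.succ_ne_zero, mul_comm]

theorem ip_K7_K7 : ip K7 K7 = 2 := by
  simp [ip_K7_right, K7, Fin.succ_ne_zero]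

/-- On the orthogonal complement of `K_7` the form is bounded by a negative multiple of the
sum of the squares of the coordinates at `E_1, …, E_7`. -/
theorem nine_mul_ip_self_le {v : Fin 8 → ℤ} (hv : ip v K7 = 0) :
    9 * ip v v ≤ -2 * ∑ i : Fin 7, v i.succ ^ 2 := by
  have hcs := sq_sum_le_card_mul_sum_sq (s := Finset.univ) (f := fun i : Fin 7 => v i.succ)
  rw [ip_K7_right] at hv
  have hsum : ∑ i : Fin 7, v i.succ = -3 * v 0 := by linarith
  simp only [hsum, Finset.card_univ, Fintype.card_fin, Nat.cast_ofNat] at hcs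
  simp only [ip_eq_sub_sum_succ, ← pow_two]
  linarith

theorem ip_self_nonpos {v : Fin 8 → ℤ} (hv : ip v K7 = 0) : ip v v ≤ 0 := by
  have h := nine_mul_ip_self_le hv
  have : 0 ≤ ∑ i : Fin 7, v i.succ ^ 2 := Finset.sum_nonneg fun i _ => sq_nonneg _
  linarith

theorem eq_zero_of_ip_self_eq_zero {v : Fin 8 → ℤ} (hv : ip v K7 = 0) (h0 : ip v v = 0) :
    v = 0 := by
  have h := nine_mul_ip_self_le hv
  have hnonneg : ∀ i ∈ Finset.univ, 0 ≤ v (Fin.succ (n := 7) i) ^ 2 := fun i _ => sq_nonneg _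
  have hsum : ∑ i : Fin 7, v i.succ ^ 2 = 0 :=
    le_antisymm (by linarith) (Finset.sum_nonneg hnonneg)
  have hsucc : ∀ i : Fin 7, v i.succ = 0 := fun i =>
    pow_eq_zero_iff two_ne_zero |>.1 ((Finset.sum_eq_zero_iff_of_nonneg hnonneg).1 hsum i
      (Finset.mem_univ i))
  rw [ip_K7_right] at hv
  simp only [hsucc, Finset.sum_const_zero] at hv
  funext i
  refine Fin.cases ?_ hsucc i
  simp only [Pi.zero_apply]
  linarith

section Pairs

variable {E E' : Fin 8 → ℤ}

theorem isClass.ip_sub_self (hE : isClass E) (hE' : isClass E') :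
    ip (E - E') (E - E') = -2 - 2 * ip E E' := by
  simp only [ip_sub_left, ip_sub_right, hE.1, hE'.1, ip_comm E' E]
  ring

theorem isClass.ip_sub_K7 (hE : isClass E) (hE' : isClass E') : ip (E - E') K7 = 0 := by
  rw [ip_sub_left, hE.2, hE'.2, sub_self]

theorem isClass.ip_add_add_self (hE : isClass E) (hE' : isClass E') :
    ip (E + E' + K7) (E + E' + K7) = 2 * ip E E' - 4 := by
  simp only [ip_add_left, ip_add_right, ip_comm K7 E, ip_comm K7 E', ip_comm E' E, hE.1, hE'.1,
    hE.2, hE'.2, ip_K7_K7]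
  ring

theorem isClass.ip_add_add_K7 (hE : isClass E) (hE' : isClass E') :
    ip (E + E' + K7) K7 = 0 := by
  simp only [ip_add_left, hE.2, hE'.2, ip_K7_K7]
  norm_num

theorem isClass.neg_one_le_ip (hE : isClass E) (hE' : isClass E') : -1 ≤ ip E E' := by
  have h := ip_self_nonpos (hE.ip_sub_K7 hE')
  rw [hE.ip_sub_self hE'] at h
  linarith

theorem isClass.ip_le_two (hE : isClass E) (hE' : isClass E') : ip E E' ≤ 2 := by
  have h := ip_self_nonpos (hE.ip_add_add_K7 hE')
  rw [hE.ip_add_add_self hE'] at h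
  linarith

theorem isClass.eq_of_ip_neg (hE : isClass E) (hE' : isClass E') (h : ip E E' < 0) :
    E' = E := by
  have hk : ip E E' = -1 := by linarith [hE.neg_one_le_ip hE', Int.add_one_le_iff.2 h]
  have h0 := eq_zero_of_ip_self_eq_zero (hE.ip_sub_K7 hE')
    (by rw [hE.ip_sub_self hE', hk]; norm_num)
  exact (sub_eq_zero.1 h0).symm

theorem isClass.eq_of_ip_eq_two (hE : isClass E) (hE' : isClass E') (h : ip E E' = 2) :
    E' = -K7 - E := by
  have h0 := eq_zero_of_ip_self_eq_zero (hE.ip_add_add_K7 hE')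
    (by rw [hE.ip_add_add_self hE', h]; norm_num)
  linear_combination h0

theorem isClass.neg_K7_sub (hE : isClass E) : isClass (-K7 - E) := by
  constructor <;>
  simp only [ip_sub_left, ip_sub_right, ip_neg_left, ip_neg_right, ip_comm K7 E, hE.1, hE.2,
    ip_K7_K7] <;> norm_num

theorem isClass.ip_neg_K7_sub (hE : isClass E) : ip E (-K7 - E') = 1 - ip E E' := by
  rw [ip_sub_right, ip_neg_right, hE.2, neg_neg]

theorem isClass.setOf_ip_eq_two (hE : isClass E) :
    {E' : Fin 8 → ℤ | isClass E' ∧ ip E E' = 2} = {-K7 - E} := by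
  ext E'
  simp only [Set.mem_ofPred_eq, Set.mem_singleton_iff]
  constructor
  · rintro ⟨hE', h⟩
    exact hE.eq_of_ip_eq_two hE' h
  · rintro rfl
    exact ⟨hE.neg_K7_sub, by rw [hE.ip_neg_K7_sub, hE.1]; norm_num⟩

/-- The involution sending a class `v` to `−K_7 − v` exchanges the classes meeting `E` in `0` and in `1`. -/
theorem isClass.ncard_ip_eq_one (hE : isClass E) :
    {E' : Fin 8 → ℤ | isClass E' ∧ ip E E' = 1}.ncard =
      {E' : Fin 8 → ℤ | isClass E' ∧ ip E E' = 0}.ncard := by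
  refine Set.ncard_congr (fun E' _ => -K7 - E') ?_ ?_ ?_
  · rintro E' ⟨hE', h⟩
    exact ⟨hE'.neg_K7_sub, by rw [hE.ip_neg_K7_sub, h, sub_self]⟩
  · rintro E₁ E₂ _ _ h
    exact sub_right_injective h
  · rintro E' ⟨hE', h⟩
    exact ⟨-K7 - E', ⟨hE'.neg_K7_sub, by rw [hE.ip_neg_K7_sub, h, sub_zero]⟩,
      sub_sub_cancel _ _⟩

end Pairs

/-- The vector of degree `d` whose other coordinates are `a - 1` on `s` and `a` off `s`. -/
def twoValued (d a : ℤ) (s : Finset (Fin 7)) : Fin 8 → ℤ :=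
  Fin.cons d fun i => a - if i ∈ s then 1 else 0

theorem twoValued_injective (d a : ℤ) : Function.Injective (twoValued d a) := by
  intro s t h
  ext i
  have hi := congrFun h i.succ
  simp only [twoValued, Fin.cons_succ] at hi
  split_ifs at hi with hs ht ht <;> simp_all only [sub_right_inj, one_ne_zero, zero_ne_one]

theorem isClass_iff (E : Fin 8 → ℤ) :
    isClass E ↔ ∑ i : Fin 7, E i.succ ^ 2 = E 0 ^ 2 + 1 ∧ ∑ i : Fin 7, E i.succ = 1 - 3 * E 0 := by
  rw [isClass, ip_K7_right, ip_eq_sub_sum_succ]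
  simp only [← pow_two]
  constructor <;> rintro ⟨h₁, h₂⟩ <;> constructor <;> linarith

theorem sum_twoValued (d a : ℤ) (s : Finset (Fin 7)) :
    ∑ i : Fin 7, twoValued d a s i.succ = 7 * a - s.card := by
  simp [twoValued, Finset.sum_sub_distrib]

theorem sum_sq_twoValued (d a : ℤ) (s : Finset (Fin 7)) :
    ∑ i : Fin 7, twoValued d a s i.succ ^ 2 = 7 * a ^ 2 + (1 - 2 * a) * s.card := by
  have h : ∀ i : Fin 7, twoValued d a s i.succ ^ 2 =
      a ^ 2 + (1 - 2 * a) * if i ∈ s then 1 else 0 := by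
    intro i
    simp only [twoValued, Fin.cons_succ]
    split_ifs <;> ring
  simp only [h, Finset.sum_add_distrib, ← Finset.mul_sum]
  simp

theorem ncard_isClass_degree {d a : ℤ} {k : ℕ} (h₁ : 7 * a - k = 1 - 3 * d)
    (h₂ : 7 * a ^ 2 + (1 - 2 * a) * k = d ^ 2 + 1) :
    {E : Fin 8 → ℤ | isClass E ∧ E 0 = d}.ncard = Nat.choose 7 k := by
  have himage : {E : Fin 8 → ℤ | isClass E ∧ E 0 = d} =
      twoValued d a '' (Finset.powersetCard k Finset.univ : Finset (Finset (Fin 7))) := by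
    ext E
    simp only [Set.mem_ofPred_eq, Set.mem_image, Finset.mem_coe, Finset.mem_powersetCard_univ,
      isClass_iff]
    constructor
    · rintro ⟨⟨hsq, hsum⟩, rfl⟩
      have hnonneg : ∀ i ∈ Finset.univ,
          0 ≤ E (Fin.succ (n := 7) i) ^ 2 - (2 * a - 1) * E i.succ + a * (a - 1) := by
        intro i _
        rcases le_or_gt a (E i.succ) with h | h
        · nlinarith
        · nlinarith [Int.add_one_le_iff.2 h]
      have hzero : ∑ i : Fin 7, (E i.succ ^ 2 - (2 * a - 1) * E i.succ + a * (a - 1)) = 0 := by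
        simp only [Finset.sum_add_distrib, Finset.sum_sub_distrib, ← Finset.mul_sum, hsq, hsum,
          Finset.sum_const, Finset.card_univ, Fintype.card_fin, nsmul_eq_mul, Nat.cast_ofNat]
        linear_combination -h₂ + (2 * a - 1) * h₁
      have hval : ∀ i : Fin 7, E i.succ = a ∨ E i.succ = a - 1 := by
        intro i
        have hi := (Finset.sum_eq_zero_iff_of_nonneg hnonneg).1 hzero i (Finset.mem_univ i)
        have hmul : (E i.succ - a) * (E i.succ - (a - 1)) = 0 := by linear_combination hi
        exact (mul_eq_zero.1 hmul).imp sub_eq_zero.1 sub_eq_zero.1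
      have hE : twoValued (E 0) a (Finset.univ.filter fun i => E i.succ = a - 1) = E := by
        funext j
        refine Fin.cases rfl (fun i => ?_) j
        rcases hval i with h | h <;> simp [twoValued, h, (sub_one_lt a).ne']
      refine ⟨_, ?_, hE⟩
      have hcard := sum_twoValued (E 0) a (Finset.univ.filter fun i => E i.succ = a - 1)
      rw [hE, hsum] at hcard
      lia
    · rintro ⟨s, rfl, rfl⟩
      refine ⟨⟨?_, ?_⟩, rfl⟩
      · rw [sum_sq_twoValued, h₂]; rfl
      · rw [sum_twoValued, h₁]; rfl
  rw [himage, Set.ncard_image_of_injective _ (twoValued_injective d a), Set.ncard_coe_finset,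
    Finset.card_powersetCard, Finset.card_univ, Fintype.card_fin]

theorem isClass.degree_mem {E : Fin 8 → ℤ} (hE : isClass E) :
    E 0 = 0 ∨ E 0 = 1 ∨ E 0 = 2 ∨ E 0 = 3 := by
  obtain ⟨hsq, hsum⟩ := (isClass_iff E).1 hE
  have hcs := sq_sum_le_card_mul_sum_sq (s := Finset.univ) (f := fun i : Fin 7 => E i.succ)
  simp only [hsq, hsum, Finset.card_univ, Fintype.card_fin, Nat.cast_ofNat] at hcs
  have hlo : -1 < E 0 := by nlinarith
  have hhi : E 0 < 4 := by nlinarith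
  lia

theorem ncard_isClass : {E : Fin 8 → ℤ | isClass E}.ncard = 56 := by
  have h₀ := ncard_isClass_degree (d := 0) (a := 1) (k := 6) (by norm_num) (by norm_num)
  have h₁ := ncard_isClass_degree (d := 1) (a := 0) (k := 2) (by norm_num) (by norm_num)
  have h₂ := ncard_isClass_degree (d := 2) (a := 0) (k := 5) (by norm_num) (by norm_num)
  have h₃ := ncard_isClass_degree (d := 3) (a := -1) (k := 1) (by norm_num) (by norm_num)
  have hunion : {E : Fin 8 → ℤ | isClass E} =
      (({E | isClass E ∧ E 0 = 0} ∪ {E | isClass E ∧ E 0 = 1}) ∪ {E | isClass E ∧ E 0 = 2}) ∪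
        {E | isClass E ∧ E 0 = 3} := by
    ext E
    have := fun hE : isClass E => hE.degree_mem
    simp only [Set.mem_ofPred_eq, Set.mem_union]
    tauto
  have f₀ := Set.finite_of_ncard_ne_zero (h₀.trans_ne (by decide))
  have f₁ := Set.finite_of_ncard_ne_zero (h₁.trans_ne (by decide))
  have f₂ := Set.finite_of_ncard_ne_zero (h₂.trans_ne (by decide))
  have f₃ := Set.finite_of_ncard_ne_zero (h₃.trans_ne (by decide))
  rw [hunion, Set.ncard_union_eq _ ((f₀.union f₁).union f₂) f₃,
    Set.ncard_union_eq _ (f₀.union f₁) f₂, Set.ncard_union_eq _ f₀ f₁, h₀, h₁, h₂, h₃]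
  · decide
  all_goals
    rw [Set.disjoint_left]
    intro E
    simp only [Set.mem_ofPred_eq, Set.mem_union]
    lia

theorem finite_setOf_isClass_and (p : (Fin 8 → ℤ) → Prop) : {E | isClass E ∧ p E}.Finite :=
  (Set.finite_of_ncard_ne_zero (ncard_isClass.trans_ne (by decide))).subset fun _ h => h.1

section Counts

variable {E : Fin 8 → ℤ}

theorem isClass.ncard_ip_pos (hE : isClass E) :
    {E' : Fin 8 → ℤ | isClass E' ∧ 0 < ip E E'}.ncard =
      {E' : Fin 8 → ℤ | isClass E' ∧ ip E E' = 0}.ncard + 1 := by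
  have hunion : {E' : Fin 8 → ℤ | isClass E' ∧ 0 < ip E E'} =
      {E' | isClass E' ∧ ip E E' = 1} ∪ {E' | isClass E' ∧ ip E E' = 2} := by
    ext E'
    have := fun hE' : isClass E' => hE.ip_le_two hE'
    simp only [Set.mem_ofPred_eq, Set.mem_union]
    lia
  rw [hunion, Set.ncard_union_eq _ (finite_setOf_isClass_and _) (finite_setOf_isClass_and _),
    hE.ncard_ip_eq_one, hE.setOf_ip_eq_two, Set.ncard_singleton]
  rw [Set.disjoint_left]
  intro E'
  simp only [Set.mem_ofPred_eq]
  lia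

theorem isClass.ncard_ip_eq_zero (hE : isClass E) :
    {E' : Fin 8 → ℤ | isClass E' ∧ ip E E' = 0}.ncard = 27 := by
  have hneg : {E' : Fin 8 → ℤ | isClass E' ∧ ip E E' < 0} = {E} := by
    ext E'
    simp only [Set.mem_ofPred_eq, Set.mem_singleton_iff]
    constructor
    · rintro ⟨hE', h⟩
      exact hE.eq_of_ip_neg hE' h
    · rintro rfl
      exact ⟨hE, by rw [hE.1]; norm_num⟩
  have hunion : {E' : Fin 8 → ℤ | isClass E'} =
      ({E' | isClass E' ∧ ip E E' < 0} ∪ {E' | isClass E' ∧ ip E E' = 0}) ∪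
        {E' | isClass E' ∧ 0 < ip E E'} := by
    ext E'
    simp only [Set.mem_ofPred_eq, Set.mem_union]
    lia
  have htotal := ncard_isClass
  rw [hunion, Set.ncard_union_eq _
    ((finite_setOf_isClass_and _).union (finite_setOf_isClass_and _))
    (finite_setOf_isClass_and _), Set.ncard_union_eq _ (finite_setOf_isClass_and _)
    (finite_setOf_isClass_and _), hE.ncard_ip_pos, hneg, Set.ncard_singleton] at htotal
  · lia
  all_goals
    rw [Set.disjoint_left]
    intro E'
    simp only [Set.mem_ofPred_eq, Set.mem_union]
    lia

end Counts

theorem statement15 :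
    (∀ E E' : Fin 8 → ℤ, isClass E → isClass E' → E ≠ E' →
      ip E E' = 0 ∨ ip E E' = 1 ∨ ip E E' = 2) ∧
    (∀ E E' : Fin 8 → ℤ, isClass E → isClass E' → ip E E' < 0 → E' = E) ∧
    (∀ E : Fin 8 → ℤ, isClass E →
      {E' : Fin 8 → ℤ | isClass E' ∧ ip E E' = 0}.ncard = 27 ∧
      {E' : Fin 8 → ℤ | isClass E' ∧ 0 < ip E E'}.ncard = 28 ∧
      {E' : Fin 8 → ℤ | isClass E' ∧ ip E E' = 2} = {-K7 - E}) := by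
  refine ⟨fun E E' hE hE' hne => ?_, fun E E' hE hE' => hE.eq_of_ip_neg hE', fun E hE =>
    ⟨hE.ncard_ip_eq_zero, by rw [hE.ncard_ip_pos, hE.ncard_ip_eq_zero], hE.setOf_ip_eq_two⟩⟩
  have hnonneg : 0 ≤ ip E E' := not_lt.1 fun h => hne (hE.eq_of_ip_neg hE' h).symm
  have := hE.ip_le_two hE'
  lia
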